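/- arXiv:1601.06124 — 4 statements merged into one kernel-verified Lean document; each statement's English description precedes it below -/
import Mathlib

section
/- Let d be a quasi-metric on a set X. Then there exist a quasi-metric d' on X, constants 0 < c₁ ≤ c₂ < ∞ and C < ∞, and a number θ ∈ (0,1) such that: (i) c₁ d(x,y) ≤ d'(x,y) ≤ c₂ d(x,y) for all x,y ∈ X; and (ii) |d'(x,z) − d'(y,z)| ≤ C r^{1−θ} d'(x,y)^θ for all x,y,z ∈ X and all r > 0 such that d'(x,z) < r and d'(y,z) < r. -/
lemma rpow_sub_bound {p a b : ℝ} (hp : 1 ≤ p) (ha : 0 < a) (hb : 0 ≤ b) :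
    a ^ p - b ^ p ≤ p * a ^ (p - 1) * (a - b) := by
  have h := one_add_mul_self_le_rpow_one_add (s := b / a - 1) (p := p)
    (by have : 0 ≤ b / a := by positivity
        linarith) hp
  have e : 1 + (b / a - 1) = b / a := by ring
  rw [e, Real.div_rpow hb ha.le] at h
  have hap : 0 < a ^ p := Real.rpow_pos_of_pos ha p
  rw [le_div_iff₀ hap] at h
  rw [Real.rpow_sub_one ha.ne']
  have : p * (a ^ p / a) * (a - b) = a ^ p - (1 + p * (b / a - 1)) * a ^ p := by
    field_simp
    ring
  linarith

lemma rpow_abs_sub_bound {p a b R : ℝ} (hp : 1 ≤ p) (ha : 0 ≤ a) (hb : 0 ≤ b)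
    (haR : a ≤ R) (hbR : b ≤ R) :
    |a ^ p - b ^ p| ≤ p * R ^ (p - 1) * |a - b| := by
  wlog hab : b ≤ a generalizing a b
  · rw [abs_sub_comm, abs_sub_comm a]
    exact this hb ha hbR haR (le_of_not_ge hab)
  rcases ha.eq_or_lt with h0 | h0
  · have : b = a := le_antisymm hab (h0 ▸ hb)
    simp [this]
  rw [abs_of_nonneg (sub_nonneg.2 hab),
    abs_of_nonneg (sub_nonneg.2 (Real.rpow_le_rpow hb hab (by linarith)))]
  refine (rpow_sub_bound hp h0 hb).trans ?_
  have := Real.rpow_le_rpow ha haR (sub_nonneg.2 hp)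
  have h2 := sub_nonneg.2 hab
  gcongr

open scoped NNReal in
/-- Frink-type metrization: if `D` satisfies a weak triangle inequality then it is equivalent
to a pseudometric. -/
lemma exists_pseudometric {X : Type*} (D : X → X → ℝ) (h0 : ∀ x y, 0 ≤ D x y)
    (hs : ∀ x, D x x = 0) (hc : ∀ x y, D x y = D y x)
    (hD : ∀ x₁ x₂ x₃ x₄, D x₁ x₄ ≤ 2 * max (D x₁ x₂) (max (D x₂ x₃) (D x₃ x₄))) :
    ∃ ρ : X → X → ℝ, (∀ x y, 0 ≤ ρ x y) ∧ (∀ x y, ρ x y = ρ y x) ∧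
      (∀ x y z, ρ x z ≤ ρ x y + ρ y z) ∧ (∀ x y, ρ x y ≤ D x y) ∧
      (∀ x y, D x y ≤ 2 * ρ x y) := by
  let E : X → X → ℝ≥0 := fun x y => ⟨D x y, h0 x y⟩
  have Es : ∀ x, E x x = 0 := fun x => NNReal.eq (hs x)
  have Ec : ∀ x y, E x y = E y x := fun x y => NNReal.eq (hc x y)
  have h1 := PseudoMetricSpace.dist_ofPreNNDist_le E Es Ec
  have h2 := PseudoMetricSpace.le_two_mul_dist_ofPreNNDist E Es Ec (fun a b c e => by
    rw [← NNReal.coe_le_coe]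
    push_cast
    exact hD a b c e)
  letI := PseudoMetricSpace.ofPreNNDist E Es Ec
  exact ⟨fun x y => dist x y, fun x y => dist_nonneg, fun x y => dist_comm x y,
    fun x y z => dist_triangle x y z, h1, h2⟩

/-- Macías–Segovia: any quasi-metric is equivalent to a Hölder-regular quasi-metric. -/
theorem stmt_0 {X : Type*} (d : X → X → ℝ) (A₀ : ℝ) (hA₀ : 1 ≤ A₀)
    (hd_nonneg : ∀ x y, 0 ≤ d x y)
    (hd_symm : ∀ x y, d x y = d y x)
    (hd_zero : ∀ x y, d x y = 0 ↔ x = y)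
    (hd_tri : ∀ x y z, d x y ≤ A₀ * (d x z + d z y)) :
    ∃ (d' : X → X → ℝ) (A₀' c₁ c₂ C θ : ℝ),
      1 ≤ A₀' ∧
      (∀ x y, 0 ≤ d' x y) ∧
      (∀ x y, d' x y = d' y x) ∧
      (∀ x y, d' x y = 0 ↔ x = y) ∧
      (∀ x y z, d' x y ≤ A₀' * (d' x z + d' z y)) ∧
      0 < c₁ ∧ c₁ ≤ c₂ ∧ 0 < C ∧ 0 < θ ∧ θ < 1 ∧
      (∀ x y, c₁ * d x y ≤ d' x y ∧ d' x y ≤ c₂ * d x y) ∧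
      (∀ x y z (r : ℝ), 0 < r → d' x z < r → d' y z < r →
        |d' x z - d' y z| ≤ C * r ^ (1 - θ) * d' x y ^ θ) := by
  obtain ⟨K, hK⟩ : ∃ K, K = 3 * A₀ ^ 2 := ⟨_, rfl⟩
  have hK3 : 3 ≤ K := by nlinarith
  have hK0 : 0 < K := by linarith
  have hlogK : 0 < Real.log K := Real.log_pos (by linarith)
  have hlog2 : 0 < Real.log 2 := Real.log_pos (by norm_num)
  obtain ⟨θ, hθ⟩ : ∃ θ, θ = Real.log 2 / Real.log K := ⟨_, rfl⟩
  have hθ0 : 0 < θ := by rw [hθ]; positivity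
  have hθ1 : θ < 1 := by
    rw [hθ, div_lt_one hlogK]
    exact Real.log_lt_log (by norm_num) (by linarith)
  have hKθ : K ^ θ = 2 := by
    rw [Real.rpow_def_of_pos hK0, hθ, mul_div_cancel₀ _ hlogK.ne', Real.exp_log (by norm_num)]
  have h2K : (2 : ℝ) ^ θ⁻¹ = K := by
    rw [← hKθ, Real.rpow_rpow_inv hK0.le hθ0.ne']
  have hp : 1 ≤ θ⁻¹ := (one_lt_inv₀ hθ0).2 hθ1 |>.le
  have hdK : ∀ a b c e, d a e ≤ K * max (d a b) (max (d b c) (d c e)) := by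
    intro a b c e
    have h1 := hd_tri a e b
    have h2 := hd_tri b e c
    set M := max (d a b) (max (d b c) (d c e)) with hM
    have m1 : d a b ≤ M := le_max_left _ _
    have m2 : d b c ≤ M := (le_max_left _ _).trans (le_max_right _ _)
    have m3 : d c e ≤ M := (le_max_right _ _).trans (le_max_right _ _)
    have hM0 : 0 ≤ M := (hd_nonneg _ _).trans m1
    have h3 : d b e ≤ A₀ * (M + M) := h2.trans (by gcongr)
    have h4 : d a e ≤ A₀ * (M + A₀ * (M + M)) := h1.trans (by gcongr)
    have h5 : A₀ * M ≤ A₀ * (A₀ * M) := by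
      gcongr
      nlinarith
    rw [hK]
    nlinarith
  obtain ⟨ρ, ρ0, ρc, ρt, ρle, leρ⟩ := exists_pseudometric (fun x y => d x y ^ θ)
    (fun x y => Real.rpow_nonneg (hd_nonneg x y) _)
    (fun x => by simp [(hd_zero x x).2 rfl, Real.zero_rpow hθ0.ne'])
    (fun x y => by simp only [hd_symm x y])
    (fun a b c e => by
      have hm : MonotoneOn (fun t : ℝ => t ^ θ) (Set.Ici 0) :=
        Real.monotoneOn_rpow_Ici_of_exponent_nonneg hθ0.le
      have h := Real.rpow_le_rpow (hd_nonneg a e) (hdK a b c e) hθ0.le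
      rw [Real.mul_rpow hK0.le (le_max_of_le_left (hd_nonneg _ _)), hKθ] at h
      have e1 := hm.map_max (a := d a b) (b := max (d b c) (d c e)) (hd_nonneg _ _)
        (le_max_of_le_left (hd_nonneg _ _))
      have e2 := hm.map_max (a := d b c) (b := d c e) (hd_nonneg _ _) (hd_nonneg _ _)
      rw [e1, e2] at h
      exact h)
  have hle : ∀ x y, ρ x y ^ θ⁻¹ ≤ d x y := fun x y => by
    have := Real.rpow_le_rpow (ρ0 x y) (ρle x y) (inv_nonneg.2 hθ0.le)
    rwa [Real.rpow_rpow_inv (hd_nonneg x y) hθ0.ne'] at this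
  have hge : ∀ x y, d x y ≤ K * ρ x y ^ θ⁻¹ := fun x y => by
    have := Real.rpow_le_rpow (Real.rpow_nonneg (hd_nonneg x y) _) (leρ x y)
      (inv_nonneg.2 hθ0.le)
    rwa [Real.rpow_rpow_inv (hd_nonneg x y) hθ0.ne', Real.mul_rpow (by norm_num) (ρ0 x y),
      h2K] at this
  have hn : ∀ x y, 0 ≤ ρ x y ^ θ⁻¹ := fun x y => Real.rpow_nonneg (ρ0 x y) _
  refine ⟨fun x y => ρ x y ^ θ⁻¹, A₀ * K, K⁻¹, 1, θ⁻¹, θ, by nlinarith, hn,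
    fun x y => by simp only [ρc x y], fun x y => ?_, fun x y z => ?_, by positivity,
    inv_le_one_of_one_le₀ (by linarith), by positivity, hθ0, hθ1, fun x y => ⟨?_, ?_⟩, ?_⟩
  · rw [← hd_zero]
    constructor
    · intro h
      have := hge x y
      simp only at h
      rw [h, mul_zero] at this
      exact le_antisymm this (hd_nonneg x y)
    · intro h
      exact le_antisymm (h ▸ hle x y) (hn x y)
  · calc ρ x y ^ θ⁻¹ ≤ A₀ * (d x z + d z y) := (hle x y).trans (hd_tri x y z)
      _ ≤ A₀ * (K * ρ x z ^ θ⁻¹ + K * ρ z y ^ θ⁻¹) := by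
        gcongr
        · exact hge x z
        · exact hge z y
      _ = _ := by ring
  · rw [inv_mul_le_iff₀ hK0]
    exact hge x y
  · rw [one_mul]
    exact hle x y
  · intro x y z r hr hx hy
    simp only at hx hy ⊢
    have key : ∀ u v, ρ u v ^ θ⁻¹ < r → ρ u v ≤ r ^ θ := fun u v h => by
      have := Real.rpow_le_rpow (hn u v) h.le hθ0.le
      rwa [Real.rpow_inv_rpow (ρ0 u v) hθ0.ne'] at this
    have h := rpow_abs_sub_bound hp (ρ0 x z) (ρ0 y z) (key _ _ hx) (key _ _ hy)
    rw [Real.rpow_inv_rpow (ρ0 x y) hθ0.ne']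
    rw [← Real.rpow_mul hr.le, mul_sub, mul_inv_cancel₀ hθ0.ne', mul_one] at h
    refine h.trans ?_
    have : |ρ x z - ρ y z| ≤ ρ x y := by
      rw [abs_le]
      have := ρt x y z
      have := ρt y x z
      have := ρc x y
      constructor <;> linarith
    gcongr
end

section
/- Let δ ∈ (0,1), θ ∈ (0,1], A, C_s > 0 and integers j ≤ l. Let K_j, K_l : X × X → ℂ be μ⊗μ-measurable kernels such that: |K_l(z,y)| ≤ A (V_{δ^l}(z) + V_{δ^l}(y))^{-1} for all z,y; K_l(z,y) = 0 whenever d(z,y) ≥ C_s δ^l; ∫_X K_l(z,y) dμ(z) = 0 for every y ∈ X; and K_j satisfies the second-difference estimate |[K_j(x,z) − K_j(x',z)] − [K_j(x,z') − K_j(x',z')]| ≤ A (d(x,x')/δ^j)^θ (d(z,z')/δ^j)^θ (V_{δ^j}(x) + V_{δ^j}(z))^{-1} for all x,x',z,z'. Then there exists a constant C', depending only on A, C_s, θ, δ, A₀ and C_μ, such that the composed kernel (K_j K_l)(x,y) := ∫_X K_j(x,z) K_l(z,y) dμ(z) satisfies |(K_j K_l)(x,y) − (K_j K_l)(x',y)|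 ≤ C' δ^{(l−j)θ} (d(x,x')/δ^j)^θ (V_{δ^j}(x) + V_{δ^j}(y))^{-1} for all x, x', y ∈ X. -/
open MeasureTheory
open scoped ENNReal

/-- Almost-orthogonality (smoothness): first-difference Hölder estimate with gain
`δ^{(l-j)θ}` for the composed kernel `K_j K_l`. -/
theorem stmt_12 {X : Type*} [MeasurableSpace X]
    (d : X → X → ℝ) (μ : Measure X) (A₀ Cμ : ℝ)
    (hA₀ : 1 ≤ A₀)
    (hd_nonneg : ∀ x y, 0 ≤ d x y)
    (hd_symm : ∀ x y, d x y = d y x)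
    (hd_zero : ∀ x y, d x y = 0 ↔ x = y)
    (hd_tri : ∀ x y z, d x y ≤ A₀ * (d x z + d z y))
    (hμ : μ ≠ 0)
    (hball : ∀ (x : X) (r : ℝ), MeasurableSet {y | d x y < r})
    (hdoub : ∀ (x : X) (r : ℝ), 0 < r →
      μ {y | d x y < 2 * r} ≤ ENNReal.ofReal Cμ * μ {y | d x y < r} ∧
        μ {y | d x y < r} < ⊤)
    (δ θ A Cs : ℝ) (hδ0 : 0 < δ) (hδ1 : δ < 1)
    (hθ0 : 0 < θ) (hθ1 : θ ≤ 1) (hA : 0 < A) (hCs : 0 < Cs) :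
    ∃ C' : ℝ, 0 < C' ∧
      ∀ (j l : ℤ), j ≤ l →
        ∀ (Kj Kl : X → X → ℂ),
          Measurable (Function.uncurry Kj) →
          Measurable (Function.uncurry Kl) →
          (∀ z y : X, ‖Kl z y‖ ≤
            A * ((μ {w | d z w < δ ^ l}).toReal + (μ {w | d y w < δ ^ l}).toReal)⁻¹) →
          (∀ z y : X, Cs * δ ^ l ≤ d z y → Kl z y = 0) →
          (∀ y : X, ∫ z, Kl z y ∂μ = 0) →
          (∀ x x' z z' : X,
            ‖(Kj x z - Kj x' z) - (Kj x z' - Kj x' z')‖ ≤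
              A * (d x x' / δ ^ j) ^ θ * (d z z' / δ ^ j) ^ θ *
                ((μ {w | d x w < δ ^ j}).toReal + (μ {w | d z w < δ ^ j}).toReal)⁻¹) →
          ∀ x x' y : X,
            ‖(∫ z, Kj x z * Kl z y ∂μ) - (∫ z, Kj x' z * Kl z y ∂μ)‖ ≤
              C' * δ ^ (((l : ℝ) - (j : ℝ)) * θ) * (d x x' / δ ^ j) ^ θ *
                ((μ {w | d x w < δ ^ j}).toReal + (μ {w | d y w < δ ^ j}).toReal)⁻¹ := by
  have hstep : ∀ (y : X) (r : ℝ), 0 < r → ∀ n : ℕ,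
      μ {w | d y w < 2 ^ n * r} ≤ ENNReal.ofReal (max Cμ 1) ^ n * μ {w | d y w < r} := by
    intro y r hr n
    induction n with
    | zero => simp
    | succ k ih =>
      have h1 := (hdoub y (2 ^ k * r) (by positivity)).1
      have e : (2 : ℝ) ^ (k + 1) * r = 2 * (2 ^ k * r) := by ring
      rw [e]
      calc _ ≤ _ := h1
        _ ≤ ENNReal.ofReal (max Cμ 1) *
            (ENNReal.ofReal (max Cμ 1) ^ k * μ {w | d y w < r}) := by
            gcongr
            exact le_max_left _ _
        _ = _ := by ring
  have hpos : ∀ (y : X) (r : ℝ), 0 < r → 0 < (μ {w | d y w < r}).toReal := by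
    intro y r hr
    refine ENNReal.toReal_pos ?_ (hdoub y r hr).2.ne
    intro h0
    apply hμ
    rw [← Measure.measure_univ_eq_zero]
    have hU : (Set.univ : Set X) = ⋃ n : ℕ, {w | d y w < 2 ^ n * r} := by
      symm
      rw [Set.eq_univ_iff_forall]
      intro w
      obtain ⟨n, hn⟩ := pow_unbounded_of_one_lt (d y w / r) (one_lt_two : (1 : ℝ) < 2)
      exact Set.mem_iUnion.2 ⟨n, (div_lt_iff₀ hr).1 hn⟩
    rw [hU, measure_iUnion_null_iff]
    intro n
    have := hstep y r hr n
    rw [h0, mul_zero] at this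
    exact le_antisymm this zero_le
  obtain ⟨n, hn⟩ := pow_unbounded_of_one_lt Cs (one_lt_two : (1 : ℝ) < 2)
  set M : ℝ := max Cμ 1 with hM
  have hM0 : 0 < M := lt_of_lt_of_le one_pos (le_max_right _ _)
  refine ⟨A * Cs ^ θ * A * M ^ n, by positivity, ?_⟩
  intro j l hjl Kj Kl mKj mKl hKl hsupp hint hKj x x' y
  have hl : 0 < δ ^ l := zpow_pos hδ0 l
  have hj : 0 < δ ^ j := zpow_pos hδ0 j
  set B : Set X := {w | d y w < Cs * δ ^ l} with hB
  have hBm : MeasurableSet B := hball _ _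
  have hBfin : μ B < ⊤ := (hdoub y (Cs * δ ^ l) (by positivity)).2
  set V : ℝ := (μ {w | d y w < δ ^ l}).toReal with hV
  have hV0 : 0 < V := hpos y _ hl
  have hBV : μ.real B ≤ M ^ n * V := by
    have h1 : μ B ≤ ENNReal.ofReal M ^ n * μ {w | d y w < δ ^ l} := by
      refine le_trans (measure_mono ?_) (hstep y _ hl n)
      intro w hw
      exact lt_trans hw (mul_lt_mul_of_pos_right hn hl)
    have h2 := ENNReal.toReal_mono
      (ENNReal.mul_ne_top (ENNReal.pow_ne_top ENNReal.ofReal_ne_top) (hdoub y _ hl).2.ne) h1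
    rwa [ENNReal.toReal_mul, ENNReal.toReal_pow, ENNReal.toReal_ofReal hM0.le] at h2
  have hKlb : ∀ z, ‖Kl z y‖ ≤ A * V⁻¹ := by
    intro z
    refine (hKl z y).trans ?_
    gcongr
    exact le_add_of_nonneg_left ENNReal.toReal_nonneg
  have hKl0 : ∀ z, z ∉ B → Kl z y = 0 := by
    intro z hz
    apply hsupp
    rw [hd_symm]
    exact not_lt.1 hz
  set W : ℝ := ((μ {w | d x w < δ ^ j}).toReal + (μ {w | d y w < δ ^ j}).toReal)⁻¹ with hW
  have hW0 : 0 ≤ W := by positivity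
  set E : ℝ := (d x x' / δ ^ j) ^ θ with hE
  have hE0 : 0 ≤ E := Real.rpow_nonneg (div_nonneg (hd_nonneg _ _) hj.le) _
  set T : ℝ := δ ^ (((l : ℝ) - (j : ℝ)) * θ) with hT
  have hT0 : 0 ≤ T := Real.rpow_nonneg hδ0.le _
  have hDb : ∀ z ∈ B, ‖(Kj x z - Kj x' z) - (Kj x y - Kj x' y)‖ ≤
      A * E * (Cs ^ θ * T) * W := by
    intro z hz
    rw [norm_sub_rev]
    refine (hKj x x' y z).trans ?_
    have key : (d y z / δ ^ j) ^ θ ≤ Cs ^ θ * T := by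
      have e : Cs ^ θ * T = (Cs * δ ^ l / δ ^ j) ^ θ := by
        rw [hT, Real.rpow_mul hδ0.le, ← Real.mul_rpow hCs.le (Real.rpow_nonneg hδ0.le _),
          Real.rpow_sub hδ0, Real.rpow_intCast, Real.rpow_intCast, mul_div_assoc]
      rw [e]
      refine Real.rpow_le_rpow (div_nonneg (hd_nonneg _ _) hj.le) ?_ hθ0.le
      exact div_le_div_of_nonneg_right (le_of_lt hz) hj.le
    gcongr
  have mKlz : Measurable fun z => Kl z y := mKl.of_uncurry_right
  have mKjx : ∀ x, Measurable fun z => Kj x z := fun x => mKj.of_uncurry_left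
  have iKl : Integrable (fun z => Kl z y) μ := by
    rw [← integrableOn_iff_integrable_of_support_subset (s := B)]
    · exact Measure.integrableOn_of_bounded hBfin.ne mKlz.aestronglyMeasurable
        (Filter.Eventually.of_forall hKlb)
    · intro z hz
      by_contra h
      exact hz (hKl0 z h)
  set c : ℂ := Kj x y - Kj x' y with hc
  set G : X → ℂ := fun z => ((Kj x z - Kj x' z) - c) * Kl z y with hG
  have hGb : ∀ z ∈ B, ‖G z‖ ≤ (A * E * (Cs ^ θ * T) * W) * (A * V⁻¹) := by
    intro z hz
    rw [hG, norm_mul]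
    exact mul_le_mul (hDb z hz) (hKlb z) (norm_nonneg _) (by positivity)
  have hG0 : ∀ z, z ∉ B → G z = 0 := by
    intro z hz
    simp [hG, hKl0 z hz]
  have mG : Measurable G := (((mKjx x).sub (mKjx x')).sub_const c).mul mKlz
  have iG : Integrable G μ := by
    rw [← integrableOn_iff_integrable_of_support_subset (s := B)]
    · exact Measure.integrableOn_of_bounded hBfin.ne mG.aestronglyMeasurable
        ((ae_restrict_iff' hBm).2 (Filter.Eventually.of_forall hGb))
    · intro z hz
      by_contra h
      exact hz (hG0 z h)
  have hGn : ‖∫ z, G z ∂μ‖ ≤ A * Cs ^ θ * A * M ^ n * T * E * W := by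
    rw [← setIntegral_eq_integral_of_forall_compl_eq_zero hG0]
    refine (norm_setIntegral_le_of_norm_le_const hBfin hGb).trans ?_
    calc _ ≤ (A * E * (Cs ^ θ * T) * W) * (A * V⁻¹) * (M ^ n * V) := by gcongr
      _ = _ := by field_simp
  have iD : Integrable (fun z => Kj x z * Kl z y - Kj x' z * Kl z y) μ := by
    have := iG.add (iKl.const_mul c)
    refine this.congr (Filter.Eventually.of_forall fun z => ?_)
    simp only [hG, Pi.add_apply]
    ring
  have hDint : ∫ z, (Kj x z * Kl z y - Kj x' z * Kl z y) ∂μ = ∫ z, G z ∂μ := by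
    have h1 : ∀ z, Kj x z * Kl z y - Kj x' z * Kl z y = G z + c * Kl z y := by
      intro z
      simp only [hG]
      ring
    simp_rw [h1]
    rw [integral_add iG (iKl.const_mul c), integral_const_mul, hint y, mul_zero, add_zero]
  by_cases h1 : Integrable (fun z => Kj x z * Kl z y) μ
  · have h2 : Integrable (fun z => Kj x' z * Kl z y) μ := by
      refine (h1.sub iD).congr (Filter.Eventually.of_forall fun z => ?_)
      simp
    rw [← integral_sub h1 h2, hDint]
    exact hGn
  · have h2 : ¬ Integrable (fun z => Kj x' z * Kl z y) μ := by
      intro h2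
      apply h1
      refine (h2.add iD).congr (Filter.Eventually.of_forall fun z => ?_)
      simp
    rw [integral_undef h1, integral_undef h2, sub_zero, norm_zero]
    positivity
end

section
/- Let 0 < p ≤ 1, δ ∈ (0,1), η > 0, γ > 0 and A ≥ 0. For each k ∈ ℤ let D_k : X × X → ℂ be a μ⊗μ-measurable kernel satisfying the second-variable Hölder estimate: |D_k(x,y) − D_k(x,y')| ≤ A (d(y,y')/(δ^k + d(x,y')))^η (V_{δ^k}(x) + V(x,y'))^{-1} (δ^k/(δ^k + d(x,y')))^γ for all x, y, y' ∈ X with d(y,y') ≤ (2A₀)^{-1}(δ^k + d(x,y')). Let a be a (p,2)-atom supported in the ball B(x₀,r). Then there exists a constant C, depending only on A, η, γ, δ, A₀, C_μ and p, such that for every x ∈ X with d(x,x₀) ≥ 2A₀ r: (Σ_{k∈ℤ} |∫_X D_k(x,y) a(y) dμ(y)|²)^{1/2} ≤ C μ(B(x₀,r))^{1 − 1/p} (r/d(x,x₀))^η V(x,x₀)^{-1}. -/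
open MeasureTheory
open scoped ENNReal


lemma aux_sum (q : ℝ) (h0 : 0 < q) (h1 : q < 1) : Summable (fun j : ℤ => q⁻¹ * q ^ j.natAbs) := by
  apply Summable.mul_left
  have := summable_geometric_of_lt_one h0.le h1
  apply Summable.of_nat_of_neg
  · simpa using this
  · simpa using this

lemma aux_term (δ η γ R : ℝ) (hδ0 : 0 < δ) (hδ1 : δ < 1) (hη : 0 < η) (hγ : 0 < γ) (hR : 0 < R) :
    ∃ m : ℤ, ∀ j : ℤ,
      ((δ ^ (m + j) / (δ ^ (m + j) + R)) ^ γ * (R / (δ ^ (m + j) + R)) ^ η) ^ 2 ≤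
        (δ ^ (min γ η))⁻¹ * (δ ^ (min γ η)) ^ j.natAbs := by
  obtain ⟨n, hn1, hn2⟩ := exists_mem_Ico_zpow (y := δ⁻¹) hR ((one_lt_inv₀ hδ0).2 hδ1)
  refine ⟨-n, fun j => ?_⟩
  set t := min γ η with ht
  have ht0 : 0 < t := lt_min hγ hη
  have hm1 : δ ^ (-n) ≤ R := by simpa [inv_zpow'] using hn1
  have hm2 : R ≤ δ ^ (-n) * δ⁻¹ := by
    have h : R < δ ^ (-n - 1) := by
      have := hn2
      rw [inv_zpow'] at this
      rwa [show -n - 1 = -(n + 1) by ring]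
    rw [zpow_sub_one₀ hδ0.ne'] at h
    exact h.le
  set e := δ ^ (-n) with he
  have he0 : 0 < e := zpow_pos hδ0 _
  rw [zpow_add₀ hδ0.ne']
  have hf0 : 0 < δ ^ j := zpow_pos hδ0 _
  set f := δ ^ j with hf
  have hs0 : 0 ≤ e * f / (e * f + R) := by positivity
  have hu0 : 0 ≤ R / (e * f + R) := by positivity
  have hs1 : e * f / (e * f + R) ≤ 1 := by
    rw [div_le_one (by positivity)]; linarith
  have hu1 : R / (e * f + R) ≤ 1 := by
    rw [div_le_one (by positivity)]; nlinarith [mul_pos he0 hf0]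
  have hS0 := Real.rpow_nonneg hs0 γ
  have hU0 := Real.rpow_nonneg hu0 η
  have hS1 := Real.rpow_le_one hs0 hs1 hγ.le
  have hU1 := Real.rpow_le_one hu0 hu1 hη.le
  have hq : (δ ^ t)⁻¹ * (δ ^ t) ^ j.natAbs = (δ⁻¹ * δ ^ j.natAbs) ^ t := by
    rw [Real.mul_rpow (by positivity) (by positivity), Real.inv_rpow hδ0.le,
      ← Real.rpow_natCast (δ ^ t), ← Real.rpow_natCast δ, ← Real.rpow_mul hδ0.le,
      ← Real.rpow_mul hδ0.le, mul_comm t]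
  have hle : ((e * f / (e * f + R)) ^ γ * (R / (e * f + R)) ^ η) ≤ (δ⁻¹ * δ ^ j.natAbs) ^ t := by
    have hinv : 1 ≤ δ⁻¹ := (one_lt_inv₀ hδ0).2 hδ1 |>.le
    rcases le_total 0 j with hj | hj
    · have hfn : f = δ ^ j.natAbs := by
        rw [hf, ← zpow_natCast, Int.natAbs_of_nonneg hj]
      calc _ ≤ (e * f / (e * f + R)) ^ γ := mul_le_of_le_one_right hS0 hU1
        _ ≤ (e * f / (e * f + R)) ^ t :=
          Real.rpow_le_rpow_of_exponent_ge' hs0 hs1 ht0.le (min_le_left _ _)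
        _ ≤ _ := by
          apply Real.rpow_le_rpow hs0 _ ht0.le
          rw [← hfn]
          calc _ ≤ f := by
                rw [div_le_iff₀ (by positivity)]
                nlinarith [mul_pos he0 hf0, mul_pos hf0 hf0, mul_pos (mul_pos he0 hf0) hf0]
            _ ≤ _ := le_mul_of_one_le_left hf0.le hinv
    · have hfn : f⁻¹ = δ ^ j.natAbs := by
        rw [hf, ← zpow_natCast, ← zpow_neg]; congr 1; omega
      calc _ ≤ (R / (e * f + R)) ^ η := mul_le_of_le_one_left hU0 hS1
        _ ≤ (R / (e * f + R)) ^ t :=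
          Real.rpow_le_rpow_of_exponent_ge' hu0 hu1 ht0.le (min_le_right _ _)
        _ ≤ _ := by
          apply Real.rpow_le_rpow hu0 _ ht0.le
          rw [← hfn]
          calc R / (e * f + R) ≤ R / (e * f) := by
                apply div_le_div_of_nonneg_left hR.le (by positivity); linarith
            _ ≤ (e * δ⁻¹) / (e * f) := by gcongr
            _ = _ := by field_simp
  rw [hq]
  refine le_trans ?_ hle
  have h0 := mul_nonneg hS0 hU0
  have h1 := mul_le_one₀ hS1 hU0 hU1
  nlinarith

lemma aux_pos {X : Type*} [MeasurableSpace X]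
    (d : X → X → ℝ) (μ : Measure X) (Cμ : ℝ) (hμ : μ ≠ 0)
    (hdoub : ∀ (x : X) (r : ℝ), 0 < r →
      μ {y | d x y < 2 * r} ≤ ENNReal.ofReal Cμ * μ {y | d x y < r} ∧
        μ {y | d x y < r} < ⊤) (x : X) (r : ℝ) (hr : 0 < r) : μ {y | d x y < r} ≠ 0 := by
  intro h
  have hn : ∀ n : ℕ, μ {y | d x y < 2 ^ n * r} = 0 := by
    intro n
    induction n with
    | zero => simpa using h
    | succ n ih =>
      have := (hdoub x (2 ^ n * r) (by positivity)).1
      rw [ih, mul_zero, ← mul_assoc, ← pow_succ'] at this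
      exact le_antisymm this zero_le
  apply hμ
  rw [← Measure.measure_univ_eq_zero]
  have hU : (Set.univ : Set X) = ⋃ n : ℕ, {y | d x y < 2 ^ n * r} := by
    symm
    rw [Set.eq_univ_iff_forall]
    intro y
    obtain ⟨n, hn⟩ := pow_unbounded_of_one_lt (d x y / r) (one_lt_two)
    exact Set.mem_iUnion.2 ⟨n, by rwa [div_lt_iff₀ hr] at hn⟩
  rw [hU, measure_iUnion_null_iff]
  exact hn

lemma aux_L1 {X : Type*} [MeasurableSpace X] (μ : Measure X) (B : Set X) (hB : MeasurableSet B)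
    (h0 : μ B ≠ 0) (hT : μ B ≠ ⊤) (p : ℝ) (a : X → ℂ) (ha : Measurable a)
    (hs : ∀ x, x ∉ B → a x = 0)
    (h2 : (∫⁻ x, (‖a x‖₊ : ℝ≥0∞) ^ 2 ∂μ) ≤ (μ B) ^ ((1 : ℝ) - 2 / p)) :
    (∫⁻ x, (‖a x‖₊ : ℝ≥0∞) ∂μ) ≤ (μ B) ^ ((1 : ℝ) - 1 / p) := by
  have H := ENNReal.lintegral_mul_le_Lp_mul_Lq μ (p := 2) (q := 2)
    (Real.HolderConjugate.two_two) (f := fun x => (‖a x‖₊ : ℝ≥0∞)) (g := B.indicator 1)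
    (by fun_prop) ((measurable_one.indicator hB).aemeasurable)
  have e1 : (fun x => (‖a x‖₊ : ℝ≥0∞)) * B.indicator 1 = fun x => (‖a x‖₊ : ℝ≥0∞) := by
    ext x
    by_cases hx : x ∈ B
    · simp [hx]
    · simp [hx, hs x hx]
  have e2 : ∫⁻ x, (B.indicator (1 : X → ℝ≥0∞) x) ^ (2 : ℝ) ∂μ = μ B := by
    rw [← lintegral_indicator_one hB]
    congr 1
    ext x
    by_cases hx : x ∈ B <;> simp [hx]
  rw [e1, e2] at H
  refine H.trans ?_
  have e3 : ∫⁻ x, (‖a x‖₊ : ℝ≥0∞) ^ (2 : ℝ) ∂μ ≤ (μ B) ^ ((1 : ℝ) - 2 / p) := by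
    refine le_trans (le_of_eq ?_) h2
    congr 1; ext x; norm_cast
  calc _ ≤ ((μ B) ^ ((1 : ℝ) - 2 / p)) ^ (1 / (2 : ℝ)) * (μ B) ^ (1 / (2 : ℝ)) := by gcongr
    _ = _ := by
      rw [← ENNReal.rpow_mul, ← ENNReal.rpow_add _ _ h0 hT]
      congr 1; ring

lemma aux_int {X : Type*} [MeasurableSpace X] (μ : Measure X) (B : Set X) (a K : X → ℂ)
    (ha : Integrable a μ) (hK : Measurable K) (h0 : ∫ x, a x ∂μ = 0)
    (hs : ∀ x, x ∉ B → a x = 0) (c : ℂ) (M L : ℝ) (hM : 0 ≤ M)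
    (hb : ∀ x ∈ B, ‖K x - c‖ ≤ M) (hL : ∫ x, ‖a x‖ ∂μ ≤ L) :
    ‖∫ x, K x * a x ∂μ‖ ≤ M * L := by
  have hp : ∀ x, ‖(K x - c) * a x‖ ≤ M * ‖a x‖ := by
    intro x
    by_cases hx : x ∈ B
    · rw [norm_mul]; gcongr; exact hb x hx
    · simp [hs x hx]
  have hi : Integrable (fun x => (K x - c) * a x) μ := by
    refine Integrable.mono' (ha.norm.const_mul M) ?_ (Filter.Eventually.of_forall hp)
    exact ((hK.sub_const c).aestronglyMeasurable).mul ha.1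
  have he : ∫ x, K x * a x ∂μ = ∫ x, (K x - c) * a x ∂μ := by
    have : ∀ x, K x * a x = (K x - c) * a x + c * a x := fun x => by ring
    simp_rw [this]
    rw [integral_add hi (ha.const_mul c), integral_const_mul, h0]; simp
  rw [he]
  calc _ ≤ ∫ x, M * ‖a x‖ ∂μ :=
        norm_integral_le_of_norm_le (ha.norm.const_mul M) (Filter.Eventually.of_forall hp)
    _ = M * ∫ x, ‖a x‖ ∂μ := integral_const_mul _ _
    _ ≤ _ := by gcongr

/-- Pointwise decay of the square function of a `(p,2)`-atom away from its
supporting ball. -/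
theorem stmt_13 {X : Type*} [MeasurableSpace X]
    (d : X → X → ℝ) (μ : Measure X) (A₀ Cμ : ℝ)
    (hA₀ : 1 ≤ A₀)
    (hd_nonneg : ∀ x y, 0 ≤ d x y)
    (hd_symm : ∀ x y, d x y = d y x)
    (hd_zero : ∀ x y, d x y = 0 ↔ x = y)
    (hd_tri : ∀ x y z, d x y ≤ A₀ * (d x z + d z y))
    (hμ : μ ≠ 0)
    (hball : ∀ (x : X) (r : ℝ), MeasurableSet {y | d x y < r})
    (hdoub : ∀ (x : X) (r : ℝ), 0 < r →
      μ {y | d x y < 2 * r} ≤ ENNReal.ofReal Cμ * μ {y | d x y < r} ∧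
        μ {y | d x y < r} < ⊤)
    (p δ η γ A : ℝ) (hp0 : 0 < p) (hp1 : p ≤ 1)
    (hδ0 : 0 < δ) (hδ1 : δ < 1) (hη : 0 < η) (hγ : 0 < γ) (hA : 0 ≤ A) :
    ∃ C : ℝ, 0 < C ∧
      ∀ D : ℤ → X → X → ℂ,
        (∀ k : ℤ, Measurable (Function.uncurry (D k))) →
        (∀ (k : ℤ) (x y y' : X), d y y' ≤ (2 * A₀)⁻¹ * (δ ^ k + d x y') →
          ‖D k x y - D k x y'‖ ≤
            A * (d y y' / (δ ^ k + d x y')) ^ η *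
              ((μ {z | d x z < δ ^ k}).toReal + (μ {z | d x z < d x y'}).toReal)⁻¹ *
              (δ ^ k / (δ ^ k + d x y')) ^ γ) →
        ∀ (x₀ : X) (r : ℝ) (a : X → ℂ), 0 < r → Measurable a →
          (∀ x : X, x ∉ {y | d x₀ y < r} → a x = 0) →
          (∫⁻ x, (‖a x‖₊ : ℝ≥0∞) ^ 2 ∂μ) ≤ (μ {y | d x₀ y < r}) ^ ((1 : ℝ) - 2 / p) →
          (∫ x, a x ∂μ) = 0 →
          ∀ x : X, 2 * A₀ * r ≤ d x x₀ →
            (∑' k : ℤ, (‖∫ y, D k x y * a y ∂μ‖₊ : ℝ≥0∞) ^ 2) ≤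
              ENNReal.ofReal ((C * (μ {y | d x₀ y < r}).toReal ^ (1 - 1 / p) *
                (r / d x x₀) ^ η * ((μ {y | d x y < d x x₀}).toReal)⁻¹) ^ 2) := by
  have hq0 : 0 < δ ^ (min γ η) := Real.rpow_pos_of_pos hδ0 _
  have hq1 : δ ^ (min γ η) < 1 := Real.rpow_lt_one hδ0.le hδ1 (lt_min hγ hη)
  have hsum := aux_sum _ hq0 hq1
  set F : ℤ → ℝ := fun j : ℤ => (δ ^ (min γ η))⁻¹ * (δ ^ (min γ η)) ^ j.natAbs with hF
  have hF0 : ∀ j, 0 ≤ F j := fun j => by simp only [hF]; positivity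
  set S := ∑' j, F j with hS
  have hS0 : 0 ≤ S := tsum_nonneg hF0
  refine ⟨(A + 1) * (S + 1), by positivity, ?_⟩
  intro D hDm hD x₀ r a hr ham hsupp h2 hint x hx
  have hR : 0 < d x x₀ := lt_of_lt_of_le (by positivity) hx
  set R := d x x₀ with hRdef
  have hBT := (hdoub x₀ r hr).2.ne
  have hB0 := aux_pos d μ Cμ hμ hdoub x₀ r hr
  have hVT := (hdoub x R hR).2.ne
  have hV0 := aux_pos d μ Cμ hμ hdoub x R hR
  set B := {y | d x₀ y < r} with hB
  have hL1 := aux_L1 μ B (hball x₀ r) hB0 hBT p a ham hsupp h2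
  have hLT : (μ B) ^ ((1 : ℝ) - 1 / p) ≠ ⊤ := ENNReal.rpow_ne_top_of_ne_zero hB0 hBT
  have hai : Integrable a μ := ⟨ham.aestronglyMeasurable, lt_of_le_of_lt hL1 hLT.lt_top⟩
  set L := (μ B).toReal ^ (1 - 1 / p) with hL
  have hL0 : 0 ≤ L := by positivity
  have haL : ∫ y, ‖a y‖ ∂μ ≤ L := by
    rw [integral_norm_eq_lintegral_enorm ham.aestronglyMeasurable, hL, ENNReal.toReal_rpow]
    exact ENNReal.toReal_mono hLT hL1
  set V := (μ {y | d x y < R}).toReal with hV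
  have hVpos : 0 < V := ENNReal.toReal_pos hV0 hVT
  set G := L * (r / R) ^ η * V⁻¹ with hG
  have hG0 : 0 ≤ G := by positivity
  have hk : ∀ k : ℤ, ‖∫ y, D k x y * a y ∂μ‖ ≤
      A * G * ((δ ^ k / (δ ^ k + R)) ^ γ * (R / (δ ^ k + R)) ^ η) := by
    intro k
    have hdk : 0 < δ ^ k := zpow_pos hδ0 k
    have key := aux_int μ B a (D k x) hai ((hDm k).comp measurable_prodMk_left) hint hsupp
      (D k x x₀) (A * (r / (δ ^ k + R)) ^ η * V⁻¹ * (δ ^ k / (δ ^ k + R)) ^ γ) L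
      (by positivity) ?_ haL
    · refine key.trans (le_of_eq ?_)
      have : r / (δ ^ k + R) = r / R * (R / (δ ^ k + R)) := by field_simp
      rw [this, Real.mul_rpow (by positivity) (by positivity), hG]
      ring
    · intro y hy
      have hy' : d y x₀ < r := by rw [hd_symm]; exact hy
      refine (hD k x y x₀ ?_).trans ?_
      · rw [inv_mul_eq_div, le_div_iff₀ (by positivity)]
        nlinarith
      · have := hd_nonneg y x₀
        rw [← hRdef, ← hV]
        gcongr
        exact le_add_of_nonneg_left ENNReal.toReal_nonneg
  obtain ⟨m, hm⟩ := aux_term δ η γ R hδ0 hδ1 hη hγ hR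
  rw [← (Equiv.addLeft m).tsum_eq]
  calc _ ≤ ∑' j : ℤ, ENNReal.ofReal ((A * G) ^ 2 * F j) := by
        refine ENNReal.tsum_le_tsum fun j => ?_
        have h1 := hk (m + j)
        have h3 := hm j
        rw [Equiv.coe_addLeft, ← enorm_eq_nnnorm, ← ofReal_norm,
          ← ENNReal.ofReal_pow (norm_nonneg _)]
        apply ENNReal.ofReal_le_ofReal
        calc _ ≤ _ := pow_le_pow_left₀ (norm_nonneg _) h1 2
          _ = (A * G) ^ 2 * _ := mul_pow _ _ _
          _ ≤ _ := by gcongr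
    _ = ENNReal.ofReal ((A * G) ^ 2 * S) := by
        rw [← ENNReal.ofReal_tsum_of_nonneg (fun j => mul_nonneg (sq_nonneg _) (hF0 j))
          (hsum.mul_left _), tsum_mul_left]
    _ ≤ _ := by
        apply ENNReal.ofReal_le_ofReal
        have : (A + 1) * (S + 1) * L * (r / R) ^ η * V⁻¹ = (A + 1) * (S + 1) * G := by
          rw [hG]; ring
        rw [this]
        have h1 : A ^ 2 ≤ (A + 1) ^ 2 := by nlinarith
        have h3 : S ≤ (S + 1) ^ 2 := by nlinarith
        calc (A * G) ^ 2 * S = A ^ 2 * S * G ^ 2 := by ring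
          _ ≤ (A + 1) ^ 2 * (S + 1) ^ 2 * G ^ 2 := by gcongr
          _ = _ := by ring
end

section
/- Suppose μ(X) = ∞. Let x₀ ∈ X and ρ > 0. Then there exists a strictly increasing sequence of integers 0 = j₀ < j₁ < j₂ < ⋯ such that for every k ≥ 1: (a) μ(B(x₀, 2^{j_k} ρ)) ≤ 2 μ(B(x₀, 2^{j_k} ρ) ∖ B(x₀, 2^{j_{k−1}} ρ)); (b) 2 μ(B(x₀, 2^{j_{k−1}} ρ)) ≤ μ(B(x₀, 2^{j_k} ρ)) ≤ 2 C_μ μ(B(x₀, 2^{j_{k−1}} ρ)); and consequently (c) μ(B(x₀, 2^{j_k} ρ)) ≥ 2^k μ(B(x₀, ρ)). -/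
open MeasureTheory
open scoped ENNReal

/-- Stopping-time annuli: existence of radii `2^{j_k} ρ` whose ball measures grow
geometrically and are comparable to the measure of the corresponding annuli. -/
theorem stmt_15 {X : Type*} [MeasurableSpace X]
    (d : X → X → ℝ) (μ : Measure X) (A₀ Cμ : ℝ)
    (hA₀ : 1 ≤ A₀)
    (hd_nonneg : ∀ x y, 0 ≤ d x y)
    (hd_symm : ∀ x y, d x y = d y x)
    (hd_zero : ∀ x y, d x y = 0 ↔ x = y)
    (hd_tri : ∀ x y z, d x y ≤ A₀ * (d x z + d z y))
    (hμ : μ ≠ 0)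
    (hball : ∀ (x : X) (r : ℝ), MeasurableSet {y | d x y < r})
    (hdoub : ∀ (x : X) (r : ℝ), 0 < r →
      μ {y | d x y < 2 * r} ≤ ENNReal.ofReal Cμ * μ {y | d x y < r} ∧
        μ {y | d x y < r} < ⊤)
    (hinf : μ Set.univ = ⊤)
    (x₀ : X) (ρ : ℝ) (hρ : 0 < ρ) :
    ∃ j : ℕ → ℕ, j 0 = 0 ∧ StrictMono j ∧
      ∀ k : ℕ, 1 ≤ k →
        (μ {y | d x₀ y < 2 ^ (j k) * ρ} ≤
          2 * μ ({y | d x₀ y < 2 ^ (j k) * ρ} \ {y | d x₀ y < 2 ^ (j (k - 1)) * ρ})) ∧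
        (2 * μ {y | d x₀ y < 2 ^ (j (k - 1)) * ρ} ≤ μ {y | d x₀ y < 2 ^ (j k) * ρ}) ∧
        (μ {y | d x₀ y < 2 ^ (j k) * ρ} ≤
          ENNReal.ofReal (2 * Cμ) * μ {y | d x₀ y < 2 ^ (j (k - 1)) * ρ}) ∧
        ((2 : ℝ≥0∞) ^ k * μ {y | d x₀ y < ρ} ≤ μ {y | d x₀ y < 2 ^ (j k) * ρ}) := by
  set f : ℕ → ℝ≥0∞ := fun n => μ {y | d x₀ y < 2 ^ n * ρ} with hf
  have hpos : ∀ n : ℕ, (0 : ℝ) < 2 ^ n * ρ := fun n => by positivity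
  have hfin : ∀ n, f n < ⊤ := fun n => (hdoub x₀ _ (hpos n)).2
  have hstep : ∀ n, f (n + 1) ≤ ENNReal.ofReal Cμ * f n := fun n => by
    have h := (hdoub x₀ _ (hpos n)).1
    have e : (2 : ℝ) ^ (n + 1) * ρ = 2 * (2 ^ n * ρ) := by ring
    simp only [hf, e]
    exact h
  have hsub : ∀ m n : ℕ, m ≤ n →
      {y | d x₀ y < 2 ^ m * ρ} ⊆ {y | d x₀ y < 2 ^ n * ρ} := by
    intro m n hmn y hy
    have h1 : (2 : ℝ) ^ m ≤ 2 ^ n := pow_le_pow_right₀ (by norm_num) hmn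
    have hy' : d x₀ y < 2 ^ m * ρ := hy
    exact lt_of_lt_of_le hy' (mul_le_mul_of_nonneg_right h1 hρ.le)
  have hmono : Monotone f := fun m n hmn => measure_mono (hsub m n hmn)
  have hU : (⋃ n : ℕ, {y | d x₀ y < 2 ^ n * ρ}) = Set.univ := by
    ext y
    simp only [Set.mem_iUnion, Set.mem_univ, iff_true]
    obtain ⟨n, hn⟩ := pow_unbounded_of_one_lt (d x₀ y / ρ) (one_lt_two)
    exact ⟨n, (div_lt_iff₀ hρ).1 hn⟩
  have hsup : (⨆ n, f n) = ⊤ := by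
    have h := Monotone.measure_iUnion (μ := μ)
      (s := fun n : ℕ => {y | d x₀ y < 2 ^ n * ρ}) (fun m n hmn => hsub m n hmn)
    rw [hU, hinf] at h
    exact h.symm
  have hex : ∀ n, ∃ m, n < m ∧ 2 * f n ≤ f m ∧ f m ≤ ENNReal.ofReal (2 * Cμ) * f n := by
    intro n
    have hE : ∃ p, 2 * f n ≤ f (n + p + 1) := by
      have hlt : 2 * f n < ⨆ n, f n := by
        rw [hsup]
        exact ENNReal.mul_lt_top (by simp) (hfin n)
      obtain ⟨q, hq⟩ := lt_iSup_iff.1 hlt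
      exact ⟨q, hq.le.trans (hmono (by omega))⟩
    classical
    have hp := Nat.find_spec hE
    have hmin : ∀ q, q < Nat.find hE → ¬ 2 * f n ≤ f (n + q + 1) :=
      fun q hq => Nat.find_min hE hq
    generalize Nat.find hE = p at hp hmin
    refine ⟨n + p + 1, by omega, hp, ?_⟩
    have hle : f (n + p) ≤ 2 * f n := by
      rcases p with _ | q
      · rw [two_mul]; exact le_self_add
      · exact (not_le.1 (hmin q (by omega))).le
    calc f (n + p + 1) ≤ ENNReal.ofReal Cμ * f (n + p) := hstep _
      _ ≤ ENNReal.ofReal Cμ * (2 * f n) := by gcongr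
      _ = ENNReal.ofReal (2 * Cμ) * f n := by
        rw [ENNReal.ofReal_mul (by norm_num)]
        simp only [ENNReal.ofReal_ofNat]
        ring
  choose g hg1 hg2 hg3 using hex
  have hs : ∀ k, g^[k + 1] 0 = g (g^[k] 0) := fun k => Function.iterate_succ_apply' g k 0
  have hc : ∀ k, (2 : ℝ≥0∞) ^ k * f 0 ≤ f (g^[k] 0) := by
    intro k
    induction k with
    | zero => simp
    | succ k ih =>
      rw [hs, pow_succ']
      calc 2 * 2 ^ k * f 0 = 2 * (2 ^ k * f 0) := by ring
        _ ≤ 2 * f (g^[k] 0) := by gcongr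
        _ ≤ _ := hg2 _
  have hf0 : μ {y | d x₀ y < ρ} = f 0 := by simp [hf]
  refine ⟨fun k => g^[k] 0, rfl, strictMono_nat_of_lt_succ fun k => ?_, ?_⟩
  · simp only [hs]; exact hg1 _
  · intro k hk
    obtain ⟨k, rfl⟩ : ∃ i, k = i + 1 := ⟨k - 1, by omega⟩
    have hck := hc (k + 1)
    rw [hf0]
    simp only [Nat.add_sub_cancel]
    simp only [hs] at hck ⊢
    generalize g^[k] 0 = n at hck ⊢
    refine ⟨?_, hg2 n, hg3 n, hck⟩
    have hdec : μ ({y | d x₀ y < 2 ^ (g n) * ρ} \ {y | d x₀ y < 2 ^ n * ρ}) + f n = f (g n) :=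
      by
          have h := measure_sdiff_add_inter (μ := μ) {y | d x₀ y < 2 ^ (g n) * ρ}
            (hball x₀ (2 ^ n * ρ))
          rwa [Set.inter_eq_right.2 (hsub n (g n) (hg1 n).le)] at h
    have h2 := hg2 n
    rw [← hdec, two_mul] at h2
    have h3 := (ENNReal.add_le_add_iff_right (hfin n).ne).1 h2
    change f (g n) ≤ _
    rw [← hdec, two_mul]
    gcongr
end
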